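/- Let (X_η, S) be a hereditary B-free subshift and let u ∈ {0,1}^ℤ be the sequence with u(0) = 1 and u(n) = 0 for n ≠ 0. If τ is a cellular automaton on (X_η, S) with τ(u) = u, then τ(x) ≤ x coordinatewise for every x ∈ X_η. -/

import Mathlib

open Filter Set

noncomputable section

/-- The shift by `t`: `(shiftPow t x) n = x (n + t)`, i.e. `S^t`. -/
def shiftPow (t : ℤ) (x : ℤ → Bool) : ℤ → Bool := fun n => x (n + t)

/-- The left shift `S`, `(S x) n = x (n + 1)`. -/
def shift : (ℤ → Bool) → (ℤ → Bool) := shiftPow 1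

/-- The support of a `0-1`-sequence. -/
def supp (x : ℤ → Bool) : Set ℤ := {n | x n = true}

/-- The all-zero sequence `0^ℤ`. -/
def zeroSeq : ℤ → Bool := fun _ => false

/-- The all-one sequence `1^ℤ`. -/
def oneSeq : ℤ → Bool := fun _ => true

/-- The sequence `u = 0^{-ℕ} 1 0^{ℕ}` with a single `1` at position `0`. -/
def uSeq : ℤ → Bool := fun n => if n = 0 then true else false

/-- The set `F_B ⊆ ℤ` of `B`-free integers. -/
def BFreeSet (B : Set ℕ) : Set ℤ := {n | ∀ b ∈ B, ¬ ((b : ℤ) ∣ n)}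

open Classical in
/-- `η`, the indicator function of the `B`-free integers. -/
noncomputable def eta (B : Set ℕ) : ℤ → Bool := fun n => if n ∈ BFreeSet B then true else false

/-- The `B`-free subshift `X_η`: the orbit closure of `η` under the shift. -/
def Xeta (B : Set ℕ) : Set (ℤ → Bool) := closure {x | ∃ t : ℤ, x = shiftPow t (eta B)}

/-- A set `A ⊆ ℤ` is `B`-admissible if for every `b ∈ B` some residue class
mod `b` is disjoint from `A`. -/
def IsBAdmissible (B : Set ℕ) (A : Set ℤ) : Prop :=
  ∀ b ∈ B, ∃ r : ℤ, ∀ a ∈ A, ¬ ((b : ℤ) ∣ (a - r))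

/-- The `B`-admissible subshift `X_B`. -/
def XB (B : Set ℕ) : Set (ℤ → Bool) := {x | IsBAdmissible B (supp x)}

/-- `B` is primitive: no element divides a different element. -/
def Primitive (B : Set ℕ) : Prop := ∀ a ∈ B, ∀ b ∈ B, a ∣ b → a = b

/-- `B` is an Erdős set: infinite, `1 ∉ B` (elements positive), primitive, pairwise
coprime and thin. -/
def IsErdos (B : Set ℕ) : Prop :=
  B.Infinite ∧ (∀ b ∈ B, 2 ≤ b) ∧ Primitive B ∧
    (∀ a ∈ B, ∀ b ∈ B, a ≠ b → Nat.Coprime a b) ∧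
    Summable (fun b : B => (1 : ℝ) / (b : ℝ))

/-- A cellular automaton on `X`: a continuous self-map of `X` commuting with the shift. -/
def IsCA (X : Set (ℤ → Bool)) (τ : (ℤ → Bool) → (ℤ → Bool)) : Prop :=
  Set.MapsTo τ X X ∧ ContinuousOn τ X ∧ ∀ x ∈ X, τ (shift x) = shift (τ x)

/-- Pre-injectivity of a CA on `X`. -/
def PreInjective (X : Set (ℤ → Bool)) (τ : (ℤ → Bool) → (ℤ → Bool)) : Prop :=
  ∀ x ∈ X, ∀ y ∈ X, τ x = τ y → {n : ℤ | x n ≠ y n}.Finite → x = y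

/-- `X` is hereditary. -/
def Hereditary (X : Set (ℤ → Bool)) : Prop :=
  ∀ x ∈ X, ∀ y : ℤ → Bool, (∀ n, y n ≤ x n) → y ∈ X

/-- The hereditary closure `X̃` of a set `X`. -/
def heredClosure (X : Set (ℤ → Bool)) : Set (ℤ → Bool) :=
  {y | ∃ x ∈ X, ∀ n, y n ≤ x n}

/-- `X` is a subshift: nonempty, closed and shift-invariant. -/
def IsSubshift (X : Set (ℤ → Bool)) : Prop :=
  X.Nonempty ∧ IsClosed X ∧ shift '' X = X

/-- `τ` is given by a (sliding block) code of radius `ℓ` on `X`. -/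
def HasRadius (X : Set (ℤ → Bool)) (τ : (ℤ → Bool) → (ℤ → Bool)) (ℓ : ℕ) : Prop :=
  ∀ x ∈ X, ∀ y ∈ X, ∀ n : ℤ,
    (∀ i : ℤ, n - ℓ ≤ i → i ≤ n + ℓ → x i = y i) → τ x n = τ y n

open Classical in
/-- `A ⊆ ℤ` has logarithmic density `d`. -/
noncomputable def HasLogDensity (A : Set ℤ) (d : ℝ) : Prop :=
  Tendsto (fun N : ℕ =>
      (Real.log N)⁻¹ * ∑ n ∈ Finset.Icc 1 N, (if (n : ℤ) ∈ A then (1 : ℝ) / (n : ℝ) else 0))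
    atTop (nhds d)

/-- `B` is taut: removing any `b ∈ B` strictly increases the logarithmic density of the
`B`-free integers. -/
def IsTaut (B : Set ℕ) : Prop :=
  ∀ b ∈ B, ∀ d d' : ℝ,
    HasLogDensity (BFreeSet B) d → HasLogDensity (BFreeSet (B \ {b})) d' → d < d'

/-- `x` and `y` are proximal: along some sequence `r k → ∞`, the shifted sequences
`S^{r k} x` and `S^{r k} y` agree on arbitrarily large central windows, i.e.
`d(S^{r k} x, S^{r k} y) → 0` in the product topology. -/
def ProximalPair (x y : ℤ → Bool) : Prop :=
  ∃ r : ℕ → ℤ, Tendsto r atTop atTop ∧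
    ∀ m : ℕ, ∀ᶠ k in atTop, ∀ n : ℤ, |n| ≤ (m : ℤ) →
      shiftPow (r k) x n = shiftPow (r k) y n

/-- A subshift is proximal if every pair of its points is proximal. -/
def IsProximalSubshift (X : Set (ℤ → Bool)) : Prop :=
  ∀ x ∈ X, ∀ y ∈ X, ProximalPair x y

end

lemma eta_eq_true_iff (B : Set ℕ) (n : ℤ) : eta B n = true ↔ n ∈ BFreeSet B := by
  simp [eta]

/-- Membership in `X_η`: every finite pattern occurs in `η`. -/
lemma mem_Xeta_iff (B : Set ℕ) (x : ℤ → Bool) :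
    x ∈ Xeta B ↔ ∀ I : Finset ℤ, ∃ t : ℤ, ∀ i ∈ I, eta B (i + t) = x i := by
  constructor
  · intro hx I
    have hopen : IsOpen ((I : Set ℤ).pi fun i => ({x i} : Set Bool)) :=
      isOpen_set_pi I.finite_toSet fun i _ => isOpen_discrete _
    obtain ⟨y, hy, t, rfl⟩ := mem_closure_iff.1 hx _ hopen fun i _ => rfl
    exact ⟨t, fun i hi => hy i hi⟩
  · intro h
    rw [Xeta, mem_closure_iff_nhds]
    intro U hU
    rw [nhds_pi, Filter.mem_pi] at hU
    obtain ⟨I, hI, s, hs, hsU⟩ := hU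
    obtain ⟨t, ht⟩ := h hI.toFinset
    refine ⟨shiftPow t (eta B), hsU fun i hi => ?_, t, rfl⟩
    have : shiftPow t (eta B) i = x i := ht i (hI.mem_toFinset.2 hi)
    rw [this]
    exact mem_of_mem_nhds (hs i)

lemma shiftPow_mem_Xeta {B : Set ℕ} {x : ℤ → Bool} (hx : x ∈ Xeta B) (t : ℤ) :
    shiftPow t x ∈ Xeta B := by
  rw [mem_Xeta_iff] at hx ⊢
  intro I
  obtain ⟨s, hs⟩ := hx (I.image (· + t))
  refine ⟨t + s, fun i hi => ?_⟩
  rw [← add_assoc]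
  exact hs _ (Finset.mem_image_of_mem _ hi)

lemma eta_mem_Xeta (B : Set ℕ) : eta B ∈ Xeta B :=
  (mem_Xeta_iff B _).2 fun _ => ⟨0, fun i _ => by rw [add_zero]⟩

/-- A cellular automaton on `X_η` commutes with every power of the shift. -/
lemma IsCA.apply_shiftPow {B : Set ℕ} {τ : (ℤ → Bool) → (ℤ → Bool)} (hτ : IsCA (Xeta B) τ)
    (t : ℤ) : ∀ x ∈ Xeta B, τ (shiftPow t x) = shiftPow t (τ x) := by
  have hshift : ∀ (s : ℤ) (x : ℤ → Bool), shift (shiftPow s x) = shiftPow (s + 1) x := by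
    intro s x
    funext n
    simp only [shift, shiftPow]
    congr 1
    ring
  induction t using Int.induction_on with
  | zero =>
    have hzero : ∀ x, shiftPow 0 x = x := fun x => funext fun n => congrArg x (add_zero n)
    intro x _
    rw [hzero, hzero]
  | succ k ih =>
    intro x hx
    rw [← hshift, hτ.2.2 _ (shiftPow_mem_Xeta hx _), ih x hx, hshift]
  | pred k ih =>
    intro x hx
    have h := hτ.2.2 _ (shiftPow_mem_Xeta hx (-(k : ℤ) - 1))
    rw [hshift, sub_add_cancel, ih x hx] at h
    funext n
    have h' := congrFun h (n - 1)
    simp only [shift, shiftPow] at h' ⊢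
    rw [show n - 1 + 1 = n by ring] at h'
    rw [← h']
    congr 1
    ring

/-- The value of a cellular automaton at a coordinate depends on finitely many coordinates
near a given point. -/
lemma IsCA.exists_window {X : Set (ℤ → Bool)} {τ : (ℤ → Bool) → (ℤ → Bool)} (hτ : IsCA X τ)
    {x : ℤ → Bool} (hx : x ∈ X) (k : ℤ) :
    ∃ l : ℕ, ∀ z ∈ X, (∀ i : ℤ, |i - k| ≤ l → z i = x i) → τ z k = τ x k := by
  have hc : ContinuousWithinAt (fun z => τ z k) X x :=
    (continuous_apply k).continuousAt.comp_continuousWithinAt (hτ.2.1 x hx)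
  have hU : (fun z => τ z k) ⁻¹' {τ x k} ∈ nhdsWithin x X :=
    hc ((isOpen_discrete _).mem_nhds rfl)
  obtain ⟨U, hU, hUX⟩ := mem_nhdsWithin_iff_exists_mem_nhds_inter.1 hU
  rw [nhds_pi, Filter.mem_pi] at hU
  obtain ⟨I, hI, s, hs, hsU⟩ := hU
  refine ⟨hI.toFinset.sup fun i => (i - k).natAbs, fun z hz h => hUX ⟨hsU fun i hi => ?_, hz⟩⟩
  have hle : (i - k).natAbs ≤ hI.toFinset.sup fun i => (i - k).natAbs :=
    Finset.le_sup (f := fun i => (i - k).natAbs) (hI.mem_toFinset.2 hi)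
  have hil : |i - k| ≤ ((hI.toFinset.sup fun i => (i - k).natAbs : ℕ) : ℤ) := by
    rw [Int.abs_eq_natAbs]
    exact_mod_cast hle
  rw [h i hil]
  exact mem_of_mem_nhds (hs i)

/-- The set of residues mod `b ∈ B` of `B`-free integers has no nontrivial period. -/
lemma dvd_of_residues_add_subset {B : Set ℕ} (hB : ∀ b ∈ B, 2 ≤ b) (hprim : Primitive B)
    {b : ℕ} (hb : b ∈ B) {t : ℤ}
    (h : ∀ f ∈ BFreeSet B, ∃ f' ∈ BFreeSet B, (b : ℤ) ∣ f + t - f') : (b : ℤ) ∣ t := by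
  by_contra hbt
  have hg : ((Int.gcd t b : ℕ) : ℤ) ∈ BFreeSet B := by
    intro c hc hcg
    have hcb : c ∣ b := by
      exact_mod_cast hcg.trans (Int.gcd_dvd_right t b)
    rw [hprim c hc b hb hcb] at hcg
    exact hbt (hcg.trans (Int.gcd_dvd_left t b))
  have hiter : ∀ k : ℕ, ∃ f ∈ BFreeSet B, (b : ℤ) ∣ Int.gcd t b + k * t - f := by
    intro k
    induction k with
    | zero => exact ⟨_, hg, by simp⟩
    | succ k ih =>
      obtain ⟨f, hf, hd⟩ := ih
      obtain ⟨f', hf', hd'⟩ := h f hf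
      refine ⟨f', hf', ?_⟩
      rw [show (Int.gcd t b : ℤ) + ((k + 1 : ℕ) : ℤ) * t - f' =
        Int.gcd t b + k * t - f + (f + t - f') by push_cast; ring]
      exact dvd_add hd hd'
  have hbpos : (0 : ℤ) < b := by have := hB b hb; omega
  obtain ⟨f, hf, hd⟩ := hiter ((-(Int.gcdA t b)) % b).toNat
  refine hf b hb ?_
  rw [Int.toNat_of_nonneg (Int.emod_nonneg _ hbpos.ne')] at hd
  obtain ⟨c, hc⟩ := hd
  have hbez := Int.gcd_eq_gcd_ab t b
  have hmod := Int.emod_add_mul_ediv (-(Int.gcdA t b)) b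
  refine ⟨Int.gcdB t b - (-(Int.gcdA t b)) / b * t - c, ?_⟩
  linear_combination (-1) * hc + hbez + hmod * t

/-- If `X_η` is hereditary, every finite set of `B`-free integers has infinitely many
`B`-free translates. -/
lemma infinite_translates {B : Set ℕ} (hB : ∀ b ∈ B, 2 ≤ b) (hhered : Hereditary (Xeta B))
    (C : Finset ℤ) (hC : ∀ c ∈ C, c ∈ BFreeSet B) :
    {t : ℤ | ∀ c ∈ C, c + t ∈ BFreeSet B}.Infinite := by
  have key : ∀ C : Finset ℤ, (∀ c ∈ C, c ∈ BFreeSet B) →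
      {t : ℤ | ∀ c ∈ C, c + t ∈ BFreeSet B}.Finite →
      ∃ t : ℤ, ∀ i : ℤ, i + t ∈ BFreeSet B ↔ i ∈ C := by
    intro C hC hfin
    by_contra! hne
    have hmem : (fun i => decide (i ∈ C)) ∈ Xeta B := by
      refine hhered _ (eta_mem_Xeta B) _ fun n hn => ?_
      exact (eta_eq_true_iff B n).2 (hC n (of_decide_eq_true hn))
    choose w hw using hne
    obtain ⟨t, ht⟩ := (mem_Xeta_iff B _).1 hmem (C ∪ hfin.toFinset.image w)
    have hiff : ∀ i ∈ C ∪ hfin.toFinset.image w, (i + t ∈ BFreeSet B ↔ i ∈ C) := by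
      intro i hi
      rw [← eta_eq_true_iff, ht i hi, decide_eq_true_iff]
    have htT : t ∈ hfin.toFinset := hfin.mem_toFinset.2 fun c hc =>
      (hiff c (Finset.mem_union_left _ hc)).2 hc
    have := hiff (w t) (Finset.mem_union_right _ (Finset.mem_image_of_mem _ htT))
    have := hw t
    tauto
  have hone : ∀ e : ℤ, e ∣ 1 → e ∈ BFreeSet B := by
    intro e he b hb hbe
    have h1 : b ∣ 1 := by exact_mod_cast hbe.trans he
    have := hB b hb
    have := Nat.dvd_one.1 h1
    omega
  intro hfin
  obtain ⟨t, ht⟩ := key C hC hfin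
  have hF : (BFreeSet B).Finite := by
    refine (C.image (· + t)).finite_toSet.subset fun n hn => ?_
    simp only [Finset.coe_image, Set.mem_image, Finset.mem_coe]
    exact ⟨n - t, (ht _).1 (by simpa using hn), by ring⟩
  obtain ⟨s, hs⟩ := key {1} (by simpa using hone 1 (dvd_refl 1)) (by
    refine (hF.image (· - 1)).subset fun n hn => ⟨1 + n, ?_, by ring⟩
    exact hn 1 (Finset.mem_singleton_self 1))
  have h1 := (hs (1 - s)).1 (by simpa using hone 1 (dvd_refl 1))
  have h2 := (hs (-1 - s)).1 (by simpa using hone (-1) (by norm_num))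
  rw [Finset.mem_singleton] at h1 h2
  omega

/-- If `X_η` is hereditary, a residue class mod `b ∈ B` containing a `B`-free integer contains
infinitely many of them. -/
lemma infinite_residue_class {B : Set ℕ} (hB : ∀ b ∈ B, 2 ≤ b) (hprim : Primitive B)
    (hhered : Hereditary (Xeta B)) {b : ℕ} (hb : b ∈ B) {C : Finset ℤ}
    (hC : ∀ c ∈ C, c ∈ BFreeSet B)
    (hcov : ∀ f ∈ BFreeSet B, ∃ c ∈ C, (b : ℤ) ∣ f - c) {e : ℤ} (he : e ∈ BFreeSet B) :
    {m : ℤ | m ∈ BFreeSet B ∧ (b : ℤ) ∣ m - e}.Infinite := by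
  obtain ⟨c, hc, hce⟩ := hcov e he
  refine ((infinite_translates hB hhered C hC).image
    (add_right_injective c).injOn).mono ?_
  rintro _ ⟨t, ht, rfl⟩
  have hbt : (b : ℤ) ∣ t := by
    refine dvd_of_residues_add_subset hB hprim hb fun f hf => ?_
    obtain ⟨d, hd, hfd⟩ := hcov f hf
    exact ⟨d + t, ht d hd, by convert hfd using 1; ring⟩
  refine ⟨ht c hc, ?_⟩
  have := dvd_sub hbt hce
  rwa [show t - (e - c) = c + t - e by ring] at this

/-- Finitely many `B`-free integers representing all occurring residues mod `b`. -/
lemma exists_finset_residues (B : Set ℕ) {b : ℕ} (hb : b ≠ 0) :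
    ∃ C : Finset ℤ, (∀ c ∈ C, c ∈ BFreeSet B) ∧
      ∀ f ∈ BFreeSet B, ∃ c ∈ C, (b : ℤ) ∣ f - c := by
  classical
  have : NeZero b := ⟨hb⟩
  have hfin : ((fun m : ℤ => (m : ZMod b)) '' BFreeSet B).Finite := Set.toFinite _
  obtain ⟨C, hC, hCim⟩ := (Finset.subset_set_image_iff (s := BFreeSet B)
    (f := fun m : ℤ => (m : ZMod b)) (t := hfin.toFinset)).1 (by rw [hfin.coe_toFinset])
  refine ⟨C, fun c hc => hC hc, fun f hf => ?_⟩
  have hmem : (f : ZMod b) ∈ C.image (fun m : ℤ => (m : ZMod b)) := by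
    rw [hCim, hfin.mem_toFinset]
    exact ⟨f, hf, rfl⟩
  obtain ⟨c, hc, hcf⟩ := Finset.mem_image.1 hmem
  exact ⟨c, hc, (ZMod.intCast_eq_intCast_iff_dvd_sub c f b).1 hcf⟩

/-- Representatives of infinite sets can be chosen far from each other and from a given point. -/
lemma exists_separated (P : ℤ → Set ℤ) (n : ℤ) (l : ℕ) (E : Finset ℤ)
    (hP : ∀ e ∈ E, (P e).Infinite) :
    ∃ D : Finset ℤ, (∀ d ∈ D, ∃ e ∈ E, d ∈ P e) ∧ (∀ e ∈ E, ∃ d ∈ D, d ∈ P e) ∧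
      (∀ d ∈ D, (2 * l : ℤ) < |d - n|) ∧ ∀ d ∈ D, ∀ d' ∈ D, d ≠ d' → (l : ℤ) < |d - d'| := by
  classical
  induction E using Finset.induction_on with
  | empty => exact ⟨∅, by simp⟩
  | insert e E _ ih =>
    obtain ⟨D, h1, h2, h3, h4⟩ := ih fun e' he' => hP e' (Finset.mem_insert_of_mem he')
    obtain ⟨m, hmP, hm⟩ := (hP e (Finset.mem_insert_self e E)).exists_notMem_finset
      (Finset.Icc (n - 2 * l) (n + 2 * l) ∪ D.biUnion fun d => Finset.Icc (d - l) (d + l))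
    simp only [Finset.mem_union, Finset.mem_Icc, Finset.mem_biUnion, not_or, not_exists,
      not_and] at hm
    have hmn : (2 * l : ℤ) < |m - n| := by
      by_contra hle
      rw [not_lt, abs_le] at hle
      exact hm.1 (by omega) (by omega)
    have hmd : ∀ d ∈ D, (l : ℤ) < |m - d| := by
      intro d hd
      by_contra hle
      rw [not_lt, abs_le] at hle
      exact hm.2 d hd (by omega) (by omega)
    refine ⟨insert m D, ?_, ?_, ?_, ?_⟩
    · rw [Finset.forall_mem_insert]
      refine ⟨⟨e, Finset.mem_insert_self _ _, hmP⟩, fun d hd => ?_⟩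
      obtain ⟨e', he', hd'⟩ := h1 d hd
      exact ⟨e', Finset.mem_insert_of_mem he', hd'⟩
    · rw [Finset.forall_mem_insert]
      refine ⟨⟨m, Finset.mem_insert_self _ _, hmP⟩, fun e' he' => ?_⟩
      obtain ⟨d, hd, hd'⟩ := h2 e' he'
      exact ⟨d, Finset.mem_insert_of_mem hd, hd'⟩
    · rw [Finset.forall_mem_insert]
      exact ⟨hmn, h3⟩
    · intro d hd d' hd' hne
      rcases Finset.mem_insert.1 hd with rfl | hdD <;>
        rcases Finset.mem_insert.1 hd' with rfl | hdD'
      · exact absurd rfl hne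
      · exact hmd d' hdD'
      · rw [abs_sub_comm]
        exact hmd d hdD
      · exact h4 d hdD d' hdD' hne

/-- on a hereditary `B`-free subshift, a CA fixing the sequence
`u = ...0001000...` satisfies `τ x ≤ x` coordinatewise. -/
theorem ca_fixing_u_is_monotone (B : Set ℕ)
    (hBpos : ∀ b ∈ B, 2 ≤ b) (hBprim : Primitive B)
    (hhered : Hereditary (Xeta B))
    (τ : (ℤ → Bool) → (ℤ → Bool)) (hτ : IsCA (Xeta B) τ)
    (hu : τ uSeq = uSeq) :
    ∀ x ∈ Xeta B, ∀ n : ℤ, τ x n ≤ x n := by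
  classical
  intro x hx k hτk
  by_contra hxk
  have huX : uSeq ∈ Xeta B := by
    have hle : ∀ n, uSeq n ≤ shiftPow 1 (eta B) n := by
      intro n hn
      have hn0 : n = 0 := by
        by_contra h
        simp [uSeq, h] at hn
      rw [hn0]
      refine (eta_eq_true_iff B _).2 fun b hb hd => ?_
      have h1 : b ∣ 1 := by exact_mod_cast (by simpa using hd : (b : ℤ) ∣ 1)
      have := hBpos b hb
      have := Nat.dvd_one.1 h1
      omega
    exact hhered _ (shiftPow_mem_Xeta (eta_mem_Xeta B) 1) _ hle
  obtain ⟨l₁, hl₁⟩ := hτ.exists_window hx k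
  obtain ⟨l₂, hl₂⟩ := hτ.exists_window huX 0
  set l := max l₁ l₂
  have hl₁l : l₁ ≤ l := le_max_left _ _
  have hl₂l : l₂ ≤ l := le_max_right _ _
  obtain ⟨t, ht⟩ := (mem_Xeta_iff B x).1 hx (Finset.Icc (k - l) (k + l))
  have hnF : k + t ∉ BFreeSet B := by
    rw [← eta_eq_true_iff, ht k (by simp)]
    exact hxk
  obtain ⟨b, hb, hbn⟩ : ∃ b ∈ B, (b : ℤ) ∣ k + t := by
    simpa [BFreeSet] using hnF
  have hb0 : b ≠ 0 := by have := hBpos b hb; omega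
  obtain ⟨C, hCF, hcov⟩ := exists_finset_residues B hb0
  obtain ⟨D, hD1, hD2, hDn, hDD⟩ := exists_separated
    (fun e => {m : ℤ | m ∈ BFreeSet B ∧ (b : ℤ) ∣ m - e}) (k + t) l C
    fun e he => infinite_residue_class hBpos hBprim hhered hb hCF hcov (hCF e he)
  have hDF : ∀ d ∈ D, d ∈ BFreeSet B := fun d hd => by
    obtain ⟨_, _, h, _⟩ := hD1 d hd
    exact h
  -- the pattern of `x` near `k`, moved to `k + t`, together with isolated ones on `D`
  let y : ℤ → Bool := fun i => decide (i ∈ BFreeSet B ∧ (|i - (k + t)| ≤ l ∨ i ∈ D))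
  have hyX : y ∈ Xeta B := hhered _ (eta_mem_Xeta B) _ fun n hn =>
    (eta_eq_true_iff B n).2 (of_decide_eq_true hn).1
  have hyn : τ y (k + t) = true := by
    have h := hl₁ (shiftPow t y) (shiftPow_mem_Xeta hyX t) fun i hi => by
      have hil : |i - k| ≤ (l : ℤ) := hi.trans (by exact_mod_cast hl₁l)
      have hab := abs_le.1 hil
      rw [← ht i (Finset.mem_Icc.2 ⟨by omega, by omega⟩), Bool.eq_iff_iff, eta_eq_true_iff]
      simp only [shiftPow, y, decide_eq_true_iff, add_sub_add_right_eq_sub]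
      tauto
    rw [hτ.apply_shiftPow t y hyX] at h
    exact h.trans hτk
  have hyD : ∀ d ∈ D, τ y d = true := by
    intro d hd
    have h := hl₂ (shiftPow d y) (shiftPow_mem_Xeta hyX d) fun i hi => by
      have hil : |i| ≤ (l : ℤ) := by
        rw [sub_zero] at hi
        exact hi.trans (by exact_mod_cast hl₂l)
      rw [Bool.eq_iff_iff]
      simp only [shiftPow, y, decide_eq_true_iff, uSeq]
      by_cases hi0 : i = 0
      · subst hi0
        simp [hd, hDF d hd]
      · simp only [hi0, if_false, Bool.false_eq_true, iff_false]
        rintro ⟨-, h | h⟩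
        · have := hDn d hd
          have h3 : |d - (k + t)| ≤ |i + d - (k + t)| + |i| := by
            have := abs_sub (i + d - (k + t)) i
            rwa [show i + d - (k + t) - i = d - (k + t) by ring] at this
          linarith
        · have := hDD _ h d hd (by omega)
          rw [add_sub_cancel_right] at this
          omega
    rw [hτ.apply_shiftPow d y hyX, hu] at h
    simpa [shiftPow, uSeq] using h
  obtain ⟨s, hs⟩ := (mem_Xeta_iff B _).1 (hτ.1 hyX) (insert (k + t) D)
  have hbs : (b : ℤ) ∣ s := by
    refine dvd_of_residues_add_subset hBpos hBprim hb fun f hf => ?_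
    obtain ⟨c, hc, hfc⟩ := hcov f hf
    obtain ⟨d, hd, -, hdc⟩ := hD2 c hc
    refine ⟨d + s, ?_, ?_⟩
    · rw [← eta_eq_true_iff, hs d (Finset.mem_insert_of_mem hd), hyD d hd]
    · rw [show f + s - (d + s) = f - c - (d - c) by ring]
      exact dvd_sub hfc hdc
  have hns : k + t + s ∈ BFreeSet B := by
    rw [← eta_eq_true_iff, hs _ (Finset.mem_insert_self _ _), hyn]
  exact hns b hb (dvd_add hbn hbs)
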